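/- arXiv:2301.09086 — 2 statements merged into one kernel-verified Lean document; each statement's English description precedes it below -/
import Mathlib

section
/- Let u be a classical solution of the wave equation on 0 < x < ℓ(t) with u(0,t) = 0 and the damped boundary condition (1 + η ℓ′(t)) u_x(ℓ(t),t) + (η + ℓ′(t)) u_t(ℓ(t),t) = 0, with η > 0, η ≠ 1. If ℓ′(t) = −1/η for t in an interval [t₁,t₂] (which forces η > 1), then u_t(ℓ(t),t) = 0 and E′(t) = −(1/(2η)) u_x(ℓ(t),t)² ≤ 0 there; if instead ℓ′(t) = −η for t ∈ [t₁,t₂] (which forces 0 < η < 1), then u_x(ℓ(t),t) = 0 and E′(t) = −(η/2) u_t(ℓ(t),t)² ≤ 0 there. -/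
open Set Filter Topology MeasureTheory Asymptotics

/-- The partial derivative in the first variable as a directional Fréchet derivative. -/
lemma hasDerivAt_fst_slice {w : ℝ × ℝ → ℝ} {x t : ℝ} (h : DifferentiableAt ℝ w (x, t)) :
    HasDerivAt (fun y => w (y, t)) (fderiv ℝ w (x, t) (1, 0)) x :=
  h.hasFDerivAt.comp_hasDerivAt x ((hasDerivAt_id x).prodMk (hasDerivAt_const x t))

/-- The partial derivative in the second variable as a directional Fréchet derivative. -/
lemma hasDerivAt_snd_slice {w : ℝ × ℝ → ℝ} {x t : ℝ} (h : DifferentiableAt ℝ w (x, t)) :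
    HasDerivAt (fun s => w (x, s)) (fderiv ℝ w (x, t) (0, 1)) t :=
  h.hasFDerivAt.comp_hasDerivAt t ((hasDerivAt_const t x).prodMk (hasDerivAt_id t))

/-- The derivative of an integral over an interval whose upper endpoint and integrand both
depend on the parameter, at a value where the interval degenerates to a point. -/
lemma hasDerivAt_integral_moving_endpoint {g : ℝ × ℝ → ℝ} {U : Set (ℝ × ℝ)} (hU : IsOpen U)
    (hg : ContinuousOn g U) {c : ℝ → ℝ} {c' t₀ : ℝ} (hc : HasDerivAt c c' t₀)
    (hmem : (c t₀, t₀) ∈ U) :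
    HasDerivAt (fun t => ∫ x in (c t₀)..(c t), g (x, t)) (c' * g (c t₀, t₀)) t₀ := by
  have hlin : HasDerivAt (fun t => (c t - c t₀) * g (c t₀, t₀)) (c' * g (c t₀, t₀)) t₀ :=
    (hc.sub_const _).mul_const _
  have hrem : HasDerivAt (fun t => (∫ x in (c t₀)..(c t), g (x, t))
      - (c t - c t₀) * g (c t₀, t₀)) 0 t₀ := by
    rw [hasDerivAt_iff_isLittleO]
    have hO : (fun t => c t - c t₀) =O[𝓝 t₀] fun t => t - t₀ := hc.isBigO_sub
    refine IsLittleO.trans_isBigO ?_ hO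
    rw [isLittleO_iff]
    intro ε hε
    have hnear : ∀ᶠ p in 𝓝 (c t₀, t₀), p ∈ U ∧ ‖g p - g (c t₀, t₀)‖ ≤ ε := by
      refine (hU.eventually_mem hmem).and ?_
      have hcont := (hg.continuousAt (hU.mem_nhds hmem)).sub_const (g (c t₀, t₀))
      exact hcont.norm.eventually_le_const (u := ε) (by simpa using hε)
    rw [nhds_prod_eq] at hnear
    obtain ⟨P, hP, Q, hQ, hPQ⟩ := eventually_prod_iff.1 hnear
    obtain ⟨δ, hδ, hball⟩ := Metric.eventually_nhds_iff_ball.1 hP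
    filter_upwards [hQ, hc.continuousAt.tendsto.eventually (Metric.ball_mem_nhds _ hδ)]
      with t htQ htc
    have hsub : uIcc (c t₀) (c t) ⊆ Metric.ball (c t₀) δ := by
      rw [← segment_eq_uIcc]
      exact (convex_ball _ _).segment_subset (Metric.mem_ball_self hδ) htc
    have hint : IntervalIntegrable (fun x => g (x, t)) volume (c t₀) (c t) := by
      refine ContinuousOn.intervalIntegrable ?_
      exact hg.comp (by fun_prop) fun x hx => (hPQ (hball x (hsub hx)) htQ).1
    have hdiff : (∫ x in (c t₀)..(c t), g (x, t)) - (c t - c t₀) * g (c t₀, t₀)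
        = ∫ x in (c t₀)..(c t), (g (x, t) - g (c t₀, t₀)) := by
      rw [intervalIntegral.integral_sub hint intervalIntegrable_const]
      simp
    simp only [intervalIntegral.integral_same, sub_self, zero_mul, smul_zero, sub_zero]
    rw [hdiff]
    exact intervalIntegral.norm_integral_le_of_norm_le_const fun x hx =>
      (hPQ (hball x (hsub (uIoc_subset_uIcc hx))) htQ).2
  exact (hrem.add hlin).congr_deriv (zero_add _) |>.congr_of_eventuallyEq
    (Eventually.of_forall fun t => by simp)

/-- Differentiation under the integral sign on a fixed compact interval. -/
lemma hasDerivAt_integral_fixed_endpoints {g : ℝ × ℝ → ℝ} {U : Set (ℝ × ℝ)} (hU : IsOpen U)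
    (hg : ContDiffOn ℝ 1 g U) {a b t₀ : ℝ} (hmem : uIcc a b ×ˢ {t₀} ⊆ U) :
    HasDerivAt (fun t => ∫ x in a..b, g (x, t)) (∫ x in a..b, fderiv ℝ g (x, t₀) (0, 1)) t₀ := by
  obtain ⟨V, W, -, hW, hV, ht₀, hVW⟩ :=
    generalized_tube_lemma isCompact_uIcc isCompact_singleton hU hmem
  obtain ⟨r, hr, hball⟩ := Metric.nhds_basis_closedBall.mem_iff.1
    (hW.mem_nhds (ht₀ (mem_singleton t₀)))
  have hsub : uIcc a b ×ˢ Metric.closedBall t₀ r ⊆ U := (prod_mono hV hball).trans hVW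
  have hderiv : ContinuousOn (fun p => fderiv ℝ g p (0, 1)) U :=
    (hg.continuousOn_fderiv_of_isOpen hU le_rfl).clm_apply continuousOn_const
  obtain ⟨C, hC⟩ := (isCompact_uIcc.prod (isCompact_closedBall t₀ r)).exists_bound_of_continuousOn
    (hderiv.mono hsub)
  have hslice : ∀ t ∈ Metric.closedBall t₀ r, ∀ f : ℝ × ℝ → ℝ, ContinuousOn f U →
      IntervalIntegrable (fun x => f (x, t)) volume a b := fun t ht f hf =>
    ContinuousOn.intervalIntegrable <| hf.comp (by fun_prop) fun x hx => hsub ⟨hx, ht⟩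
  have hcenter : t₀ ∈ Metric.closedBall t₀ r := Metric.mem_closedBall_self hr.le
  refine (intervalIntegral.hasDerivAt_integral_of_dominated_loc_of_deriv_le
    (F := fun t x => g (x, t)) (F' := fun t x => fderiv ℝ g (x, t) (0, 1)) (bound := fun _ => C)
    (Metric.closedBall_mem_nhds t₀ hr) ?_ ?_ ?_ ?_ ?_ ?_).2
  · filter_upwards [Metric.closedBall_mem_nhds t₀ hr] with t ht
    exact (hslice t ht g hg.continuousOn).def'.aestronglyMeasurable
  · exact hslice t₀ hcenter g hg.continuousOn
  · exact (hslice t₀ hcenter _ hderiv).def'.aestronglyMeasurable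
  · exact Eventually.of_forall fun x hx t ht => hC (x, t) ⟨uIoc_subset_uIcc hx, ht⟩
  · exact intervalIntegrable_const
  · refine Eventually.of_forall fun x hx t ht => hasDerivAt_snd_slice ?_
    exact (hg.differentiableOn one_ne_zero).differentiableAt
      (hU.mem_nhds (hsub ⟨uIoc_subset_uIcc hx, ht⟩))

/-- Leibniz integral rule with a moving upper endpoint. -/
lemma hasDerivAt_integral_of_moving_upper {g : ℝ × ℝ → ℝ} {U : Set (ℝ × ℝ)} (hU : IsOpen U)
    (hg : ContDiffOn ℝ 1 g U) {a : ℝ} {c : ℝ → ℝ} {c' t₀ : ℝ} (hc : HasDerivAt c c' t₀)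
    (hmem : uIcc a (c t₀) ×ˢ {t₀} ⊆ U) :
    HasDerivAt (fun t => ∫ x in a..(c t), g (x, t))
      ((∫ x in a..(c t₀), fderiv ℝ g (x, t₀) (0, 1)) + c' * g (c t₀, t₀)) t₀ := by
  refine ((hasDerivAt_integral_fixed_endpoints hU hg hmem).add
    (hasDerivAt_integral_moving_endpoint hU hg.continuousOn hc
      (hmem ⟨right_mem_uIcc, rfl⟩))).congr_of_eventuallyEq ?_
  obtain ⟨V, W, hVo, hW, hV, ht₀, hVW⟩ :=
    generalized_tube_lemma isCompact_uIcc isCompact_singleton hU hmem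
  obtain ⟨δ, hδ, hball⟩ := Metric.nhds_basis_ball.mem_iff.1
    (hVo.mem_nhds (hV right_mem_uIcc))
  filter_upwards [hW.mem_nhds (ht₀ (mem_singleton t₀)),
    hc.continuousAt.tendsto.eventually (Metric.ball_mem_nhds _ hδ)] with t htW htc
  have hsub : uIcc (c t₀) (c t) ⊆ V := by
    rw [← segment_eq_uIcc]
    exact ((convex_ball _ _).segment_subset (Metric.mem_ball_self hδ) htc).trans hball
  have hint : ∀ p q : ℝ, uIcc p q ⊆ V →
      IntervalIntegrable (fun x => g (x, t)) volume p q := fun p q hpq =>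
    ContinuousOn.intervalIntegrable <|
      hg.continuousOn.comp (by fun_prop) fun x hx => hVW ⟨hpq hx, htW⟩
  exact (intervalIntegral.integral_add_adjacent_intervals (hint _ _ hV) (hint _ _ hsub)).symm

/-- The energy balance for a classical solution of the wave equation on a segment with one
fixed end and one moving end. -/
lemma hasDerivAt_energy_of_wave {u : ℝ → ℝ → ℝ} {U : Set (ℝ × ℝ)} (hU : IsOpen U)
    (hu : ContDiffOn ℝ 2 (fun p : ℝ × ℝ => u p.1 p.2) U)
    {ℓ : ℝ → ℝ} {v t₀ : ℝ} (hℓ : HasDerivAt ℓ v t₀) (hpos : 0 < ℓ t₀)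
    (hsub : ∀ᶠ t in 𝓝 t₀, ∀ x ∈ Icc 0 (ℓ t), (x, t) ∈ U)
    (hwave : ∀ x ∈ Icc 0 (ℓ t₀),
      deriv (deriv (u x)) t₀ = deriv (deriv (fun y => u y t₀)) x)
    (hbc : ∀ᶠ t in 𝓝 t₀, u 0 t = 0) :
    HasDerivAt (fun t => (1/2) * ∫ x in (0:ℝ)..(ℓ t),
        ((deriv (u x) t)^2 + (deriv (fun y => u y t) x)^2))
      (deriv (fun y => u y t₀) (ℓ t₀) * deriv (u (ℓ t₀)) t₀
        + v / 2 * ((deriv (u (ℓ t₀)) t₀)^2 + (deriv (fun y => u y t₀) (ℓ t₀))^2)) t₀ := by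
  set w : ℝ × ℝ → ℝ := fun p => u p.1 p.2 with hw
  set a : ℝ × ℝ → ℝ := fun p => fderiv ℝ w p (1, 0) with ha
  set b : ℝ × ℝ → ℝ := fun p => fderiv ℝ w p (0, 1) with hb
  have hDw : ContDiffOn ℝ 1 (fderiv ℝ w) U := hu.fderiv_of_isOpen hU (by norm_num)
  have haC : ContDiffOn ℝ 1 a U := hDw.clm_apply contDiffOn_const
  have hbC : ContDiffOn ℝ 1 b U := hDw.clm_apply contDiffOn_const
  have hdiff : ∀ {f : ℝ × ℝ → ℝ}, ContDiffOn ℝ 1 f U → ∀ p ∈ U, DifferentiableAt ℝ f p :=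
    fun hf p hp => (hf.differentiableOn one_ne_zero).differentiableAt (hU.mem_nhds hp)
  have hux : ∀ x t, (x, t) ∈ U → deriv (fun y => u y t) x = a (x, t) := fun x t h =>
    (hasDerivAt_fst_slice (hdiff (hu.of_le (by norm_num)) _ h)).deriv
  have hut : ∀ x t, (x, t) ∈ U → deriv (u x) t = b (x, t) := fun x t h =>
    (hasDerivAt_snd_slice (hdiff (hu.of_le (by norm_num)) _ h)).deriv
  have huxx : ∀ x t, (x, t) ∈ U →
      deriv (deriv (fun y => u y t)) x = fderiv ℝ a (x, t) (1, 0) := by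
    intro x t h
    rw [← (hasDerivAt_fst_slice (hdiff haC _ h)).deriv]
    refine EventuallyEq.deriv_eq ?_
    have hc : ContinuousAt (fun y : ℝ => (y, t)) x := by fun_prop
    filter_upwards [hc.preimage_mem_nhds (hU.mem_nhds h)] with y hy using hux y t hy
  have hutt : ∀ x t, (x, t) ∈ U →
      deriv (deriv (u x)) t = fderiv ℝ b (x, t) (0, 1) := by
    intro x t h
    rw [← (hasDerivAt_snd_slice (hdiff hbC _ h)).deriv]
    refine EventuallyEq.deriv_eq ?_
    have hc : ContinuousAt (fun s : ℝ => (x, s)) t := by fun_prop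
    filter_upwards [hc.preimage_mem_nhds (hU.mem_nhds h)] with s hs using hut x s hs
  have hmixed : ∀ p ∈ U, fderiv ℝ a p (0, 1) = fderiv ℝ b p (1, 0) := by
    intro p hp
    have hD : DifferentiableAt ℝ (fderiv ℝ w) p :=
      (hDw.differentiableOn one_ne_zero).differentiableAt (hU.mem_nhds hp)
    have hsymm : IsSymmSndFDerivAt ℝ w p :=
      (hu.contDiffAt (hU.mem_nhds hp)).isSymmSndFDerivAt (by simp)
    have happ : ∀ d e : ℝ × ℝ,
        fderiv ℝ (fun q => fderiv ℝ w q d) p e = fderiv ℝ (fderiv ℝ w) p e d := by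
      intro d e
      rw [fderiv_clm_apply hD (differentiableAt_const d)]
      simp
    rw [ha, hb, happ, happ]
    exact hsymm _ _
  have hmem : ∀ x ∈ Icc 0 (ℓ t₀), (x, t₀) ∈ U := hsub.self_of_nhds
  have huIcc : uIcc 0 (ℓ t₀) = Icc 0 (ℓ t₀) := uIcc_of_le hpos.le
  have hend : (ℓ t₀, t₀) ∈ U := hmem _ (right_mem_Icc.2 hpos.le)
  have hzero : (0, t₀) ∈ U := hmem _ (left_mem_Icc.2 hpos.le)
  have hgC : ContDiffOn ℝ 1 (fun p => b p ^ 2 + a p ^ 2) U := (hbC.pow 2).add (haC.pow 2)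
  have hleib := (hasDerivAt_integral_of_moving_upper hU hgC hℓ (a := 0) (by
    rw [huIcc]
    rintro ⟨x, t⟩ ⟨hx, rfl⟩
    exact hmem x hx)).const_mul (1/2)
  have hE : (fun t => (1/2) * ∫ x in (0:ℝ)..(ℓ t),
      ((deriv (u x) t)^2 + (deriv (fun y => u y t) x)^2)) =ᶠ[𝓝 t₀]
      fun t => (1/2) * ∫ x in (0:ℝ)..(ℓ t), (b (x, t) ^ 2 + a (x, t) ^ 2) := by
    filter_upwards [hsub, hℓ.continuousAt.tendsto.eventually (lt_mem_nhds hpos)] with t ht hlt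
    congr 1
    refine intervalIntegral.integral_congr fun x hx => ?_
    rw [uIcc_of_le hlt.le] at hx
    simp only [hux x t (ht x hx), hut x t (ht x hx)]
  refine (hleib.congr_of_eventuallyEq hE).congr_deriv ?_
  have hb0 : b (0, t₀) = 0 := by
    rw [← hut 0 t₀ hzero]
    exact (EventuallyEq.deriv_eq (f := fun _ => (0:ℝ)) hbc).trans (deriv_const _ _)
  have hpt : ∀ x ∈ Icc 0 (ℓ t₀), fderiv ℝ (fun p => b p ^ 2 + a p ^ 2) (x, t₀) (0, 1)
      = 2 * (fderiv ℝ a (x, t₀) (1, 0) * b (x, t₀) + a (x, t₀) * fderiv ℝ b (x, t₀) (1, 0)) := by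
    intro x hx
    have hp := hmem x hx
    have h₁ := hasDerivAt_snd_slice (hdiff hgC _ hp)
    have h₂ := ((hasDerivAt_snd_slice (hdiff hbC _ hp)).pow 2).add
      ((hasDerivAt_snd_slice (hdiff haC _ hp)).pow 2)
    rw [h₁.unique h₂, hmixed _ hp, ← hutt x t₀ hp, hwave x hx, huxx x t₀ hp]
    simp only [Nat.cast_ofNat, Nat.add_one_sub_one, pow_one]
    ring
  have hFTC : ∫ x in (0:ℝ)..(ℓ t₀), (fderiv ℝ a (x, t₀) (1, 0) * b (x, t₀)
      + a (x, t₀) * fderiv ℝ b (x, t₀) (1, 0)) = a (ℓ t₀, t₀) * b (ℓ t₀, t₀) := by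
    rw [intervalIntegral.integral_eq_sub_of_hasDerivAt (f := fun x => a (x, t₀) * b (x, t₀))]
    · simp [hb0]
    · intro x hx
      rw [huIcc] at hx
      exact (hasDerivAt_fst_slice (hdiff haC _ (hmem x hx))).mul
        (hasDerivAt_fst_slice (hdiff hbC _ (hmem x hx)))
    · refine ContinuousOn.intervalIntegrable ?_
      have hDcont : ∀ {f : ℝ × ℝ → ℝ}, ContDiffOn ℝ 1 f U →
          ContinuousOn (fun p => fderiv ℝ f p (1, 0)) U := fun hf =>
        (hf.continuousOn_fderiv_of_isOpen hU le_rfl).clm_apply continuousOn_const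
      have hcont := ((hDcont haC).mul hbC.continuousOn).add (haC.continuousOn.mul (hDcont hbC))
      refine hcont.comp (f := fun x : ℝ => (x, t₀)) (by fun_prop) fun x hx => hmem x ?_
      rwa [huIcc] at hx
  rw [intervalIntegral.integral_congr (g := fun x => 2 * (fderiv ℝ a (x, t₀) (1, 0) * b (x, t₀)
      + a (x, t₀) * fderiv ℝ b (x, t₀) (1, 0))) fun x hx => hpt x (huIcc ▸ hx),
    intervalIntegral.integral_const_mul, hFTC, hux _ _ hend, hut _ _ hend]
  ring

theorem damped_special_speeds
    (ℓ ℓ' : ℝ → ℝ)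
    (hℓC1 : ContDiffOn ℝ 1 ℓ (Set.Ici 0))
    (hℓd : ∀ t ∈ Set.Ici (0:ℝ), HasDerivWithinAt ℓ (ℓ' t) (Set.Ici 0) t)
    (hℓpos : ∀ t ∈ Set.Ici (0:ℝ), 0 < ℓ t)
    (hℓspeed : ∀ t ∈ Set.Ici (0:ℝ), |ℓ' t| < 1)
    (u : ℝ → ℝ → ℝ) (U : Set (ℝ × ℝ)) (hUopen : IsOpen U)
    (hUK : {p : ℝ × ℝ | 0 ≤ p.2 ∧ p.1 ∈ Set.Icc 0 (ℓ p.2)} ⊆ U)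
    (huC2 : ContDiffOn ℝ 2 (fun p : ℝ × ℝ => u p.1 p.2) U)
    (hwave : ∀ x t : ℝ, 0 ≤ t → x ∈ Set.Icc 0 (ℓ t) →
      deriv (deriv (u x)) t = deriv (deriv (fun y => u y t)) x)
    (hbc0 : ∀ t : ℝ, 0 ≤ t → u 0 t = 0)
    (η : ℝ) (hη0 : 0 < η) (hη1 : η ≠ 1)
    (hbcℓ : ∀ t : ℝ, 0 < t →
      (1 + η * ℓ' t) * deriv (fun y => u y t) (ℓ t)
        + (η + ℓ' t) * deriv (u (ℓ t)) t = 0)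
    (E : ℝ → ℝ)
    (hE : ∀ t : ℝ, E t = (1/2) * ∫ x in (0:ℝ)..(ℓ t),
      ((deriv (u x) t)^2 + (deriv (fun y => u y t) x)^2))
    (t₁ t₂ : ℝ) (ht₁ : 0 < t₁) (ht₁₂ : t₁ ≤ t₂)
    : ((∀ t ∈ Set.Icc t₁ t₂, ℓ' t = -(1/η)) →
        1 < η ∧ ∀ t ∈ Set.Icc t₁ t₂,
          deriv (u (ℓ t)) t = 0 ∧
          HasDerivAt E (-(1/(2*η)) * (deriv (fun y => u y t) (ℓ t))^2) t ∧
          -(1/(2*η)) * (deriv (fun y => u y t) (ℓ t))^2 ≤ 0) ∧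
      ((∀ t ∈ Set.Icc t₁ t₂, ℓ' t = -η) →
        η < 1 ∧ ∀ t ∈ Set.Icc t₁ t₂,
          deriv (fun y => u y t) (ℓ t) = 0 ∧
          HasDerivAt E (-(η/2) * (deriv (u (ℓ t)) t)^2) t ∧
          -(η/2) * (deriv (u (ℓ t)) t)^2 ≤ 0) := by
  have henergy : ∀ t, 0 < t → HasDerivAt E (deriv (fun y => u y t) (ℓ t) * deriv (u (ℓ t)) t
      + ℓ' t / 2 * ((deriv (u (ℓ t)) t)^2 + (deriv (fun y => u y t) (ℓ t))^2)) t := by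
    intro t ht
    rw [funext hE]
    refine hasDerivAt_energy_of_wave hUopen huC2
      ((hℓd t ht.le).hasDerivAt (Ici_mem_nhds ht)) (hℓpos t ht.le) ?_
      (fun x hx => hwave x t ht.le hx) ?_
    · filter_upwards [lt_mem_nhds ht] with s hs x hx using hUK ⟨hs.le, hx⟩
    · filter_upwards [lt_mem_nhds ht] with s hs using hbc0 s hs.le
  have hη : η ^ 2 - 1 ≠ 0 := by
    intro h
    rcases mul_eq_zero.1 (show (η - 1) * (η + 1) = 0 by linarith) with h | h
    · exact hη1 (by linarith)
    · linarith
  refine ⟨fun h => ⟨?_, fun t ht => ?_⟩, fun h => ⟨?_, fun t ht => ?_⟩⟩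
  · have hs := hℓspeed t₁ ht₁.le
    rw [h t₁ (left_mem_Icc.2 ht₁₂), abs_neg, abs_of_pos (by positivity), div_lt_one hη0] at hs
    exact hs
  · have ht0 : 0 < t := ht₁.trans_le ht.1
    have hut : deriv (u (ℓ t)) t = 0 := by
      have hbc := hbcℓ t ht0
      rw [h t ht] at hbc
      field_simp at hbc
      have : (η ^ 2 - 1) * deriv (u (ℓ t)) t = 0 := by linarith
      exact (mul_eq_zero.1 this).resolve_left hη
    refine ⟨hut, (henergy t ht0).congr_deriv ?_, ?_⟩
    · rw [hut, h t ht]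
      field_simp
      ring
    · rw [neg_mul, neg_nonpos]
      positivity
  · have hs := hℓspeed t₁ ht₁.le
    rwa [h t₁ (left_mem_Icc.2 ht₁₂), abs_neg, abs_of_pos hη0] at hs
  · have ht0 : 0 < t := ht₁.trans_le ht.1
    have hux : deriv (fun y => u y t) (ℓ t) = 0 := by
      have hbc := hbcℓ t ht0
      rw [h t ht] at hbc
      have : (η ^ 2 - 1) * deriv (fun y => u y t) (ℓ t) = 0 := by linarith
      exact (mul_eq_zero.1 this).resolve_left hη
    refine ⟨hux, (henergy t ht0).congr_deriv ?_, ?_⟩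
    · rw [hux, h t ht]
      ring
    · rw [neg_mul, neg_nonpos]
      positivity
end

section
/- In the damped case (η > 0, η ≠ 1, boundary condition (1 + η ℓ′(t)) u_x(ℓ(t),t) + (η + ℓ′(t)) u_t(ℓ(t),t) = 0), define m(t) = min over x ∈ [0,ℓ(t)] of {φ′(t−x), φ′(t+x)} and M(t) = max over x ∈ [0,ℓ(t)] of {φ′(t−x), φ′(t+x)}. Then for all 0 ≤ t₀ < t: (e^{ln|γ_η| φ(t₀ − ℓ(t₀))}/M(t₀)) · m(t) · e^{−ln|γ_η| φ(t + ℓ(t))} · E(t₀) ≤ E(t) ≤ (e^{ln|γ_η| φ(t₀ + ℓ(t₀))}/m(t₀)) · M(t) · e^{−ln|γ_η| φ(t − ℓ(t))} · E(t₀). -/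
open Set

section WaveEquation

variable {f : ℝ × ℝ → ℝ} {U : Set (ℝ × ℝ)}

theorem ContDiffOn.hasDerivAt_comp_curve (hf : ContDiffOn ℝ 2 f U) (hU : IsOpen U)
    {c : ℝ → ℝ × ℝ} {v : ℝ × ℝ} {s : ℝ} (hc : HasDerivAt c v s) (hs : c s ∈ U) :
    HasDerivAt (fun r => f (c r)) (fderiv ℝ f (c s) v) s :=
  (((hf.contDiffAt (hU.mem_nhds hs)).differentiableAt
    two_ne_zero).hasFDerivAt).comp_hasDerivAt s hc

theorem ContDiffOn.hasDerivAt_fderiv_comp_curve (hf : ContDiffOn ℝ 2 f U) (hU : IsOpen U)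
    {c : ℝ → ℝ × ℝ} {v : ℝ × ℝ} {s : ℝ} (hc : HasDerivAt c v s) (hs : c s ∈ U) (w : ℝ × ℝ) :
    HasDerivAt (fun r => fderiv ℝ f (c r) w) (fderiv ℝ (fderiv ℝ f) (c s) v w) s := by
  have h1 : DifferentiableAt ℝ (fderiv ℝ f) (c s) :=
    ((hf.contDiffAt (hU.mem_nhds hs)).fderiv_right (m := 1) (by norm_num)).differentiableAt
      one_ne_zero
  exact (h1.hasFDerivAt.comp_hasDerivAt s hc).clm_apply (hasDerivAt_const s w) |>.congr_deriv
    (by simp)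

theorem hasDerivAt_prodMk_right (x t : ℝ) :
    HasDerivAt (fun s : ℝ => (x, s)) ((0, 1) : ℝ × ℝ) t :=
  (hasDerivAt_const t x).prodMk (hasDerivAt_id t)

theorem hasDerivAt_prodMk_left (x t : ℝ) :
    HasDerivAt (fun y : ℝ => (y, t)) ((1, 0) : ℝ × ℝ) x :=
  (hasDerivAt_id x).prodMk (hasDerivAt_const x t)

theorem ContDiffOn.deriv_deriv_comp_curve (hf : ContDiffOn ℝ 2 f U) (hU : IsOpen U)
    {c : ℝ → ℝ × ℝ} {v : ℝ × ℝ} (hc : ∀ s, HasDerivAt c v s) {s : ℝ} (hs : c s ∈ U) :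
    deriv (deriv fun r => f (c r)) s = fderiv ℝ (fderiv ℝ f) (c s) v v := by
  have hev : deriv (fun r => f (c r)) =ᶠ[nhds s] fun r => fderiv ℝ f (c r) v := by
    filter_upwards [(hc s).continuousAt.preimage_mem_nhds (hU.mem_nhds hs)] with r hr
    exact (hf.hasDerivAt_comp_curve hU (hc r) hr).deriv
  rw [hev.deriv_eq]
  exact (hf.hasDerivAt_fderiv_comp_curve hU (hc s) hs v).deriv

/-- A directional derivative is constant along a segment on which its derivative vanishes. -/
theorem ContDiffOn.fderiv_apply_eq_of_segment (hf : ContDiffOn ℝ 2 f U) (hU : IsOpen U)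
    {z v w : ℝ × ℝ} {a : ℝ} (ha : 0 ≤ a) (hmem : ∀ s ∈ Icc 0 a, z + s • v ∈ U)
    (hzero : ∀ s ∈ Icc 0 a, fderiv ℝ (fderiv ℝ f) (z + s • v) v w = 0) :
    fderiv ℝ f (z + a • v) w = fderiv ℝ f z w := by
  have hc : ∀ s : ℝ, HasDerivAt (fun r : ℝ => z + r • v) v s := fun s => by
    simpa using ((hasDerivAt_id s).smul_const v).const_add z
  have hd : ∀ s ∈ Icc 0 a, HasDerivAt (fun r => fderiv ℝ f (z + r • v) w) 0 s := fun s hs => by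
    simpa [hzero s hs] using hf.hasDerivAt_fderiv_comp_curve hU (hc s) (hmem s hs) w
  have := constant_of_has_deriv_right_zero
    (fun s hs => (hd s hs).continuousAt.continuousWithinAt)
    (fun s hs => (hd s (Ico_subset_Icc_self hs)).hasDerivWithinAt) a (right_mem_Icc.2 ha)
  simpa using this

/-- The wave operator factors through the two characteristic directions. -/
theorem ContDiffOn.fderiv_fderiv_characteristic (hf : ContDiffOn ℝ 2 f U) (hU : IsOpen U)
    {x t : ℝ} (hz : (x, t) ∈ U)
    (hwave : deriv (deriv fun s => f (x, s)) t = deriv (deriv fun y => f (y, t)) x) :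
    fderiv ℝ (fderiv ℝ f) (x, t) (-1, 1) (1, 1) = 0 ∧
      fderiv ℝ (fderiv ℝ f) (x, t) (1, 1) (-1, 1) = 0 := by
  have hsym : IsSymmSndFDerivAt ℝ f (x, t) :=
    (hf.contDiffAt (hU.mem_nhds hz)).isSymmSndFDerivAt (by simp)
  rw [hf.deriv_deriv_comp_curve hU (hasDerivAt_prodMk_right x) hz,
    hf.deriv_deriv_comp_curve hU (c := fun y => (y, t))
      (fun y => hasDerivAt_prodMk_left y t) hz] at hwave
  have hkey : fderiv ℝ (fderiv ℝ f) (x, t) (-1, 1) (1, 1) = 0 := by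
    have e1 : ((-1, 1) : ℝ × ℝ) = (0, 1) - (1, 0) := by simp
    have e2 : ((1, 1) : ℝ × ℝ) = (0, 1) + (1, 0) := by simp
    rw [e1, e2]
    simp only [map_sub, map_add, sub_apply]
    rw [hwave, hsym.eq (0, 1) (1, 0)]
    ring
  exact ⟨hkey, (hsym.eq _ _).trans hkey⟩

end WaveEquation

section MovingBoundary

variable {ℓ ℓ' : ℝ → ℝ}

theorem abs_sub_le_of_abs_hasDerivWithinAt_lt_one
    (hℓd : ∀ t ∈ Ici (0:ℝ), HasDerivWithinAt ℓ (ℓ' t) (Ici 0) t)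
    (hℓspeed : ∀ t ∈ Ici (0:ℝ), |ℓ' t| < 1) {s t : ℝ} (hs : 0 ≤ s) (ht : 0 ≤ t) :
    |ℓ t - ℓ s| ≤ |t - s| := by
  simpa using (convex_Ici (0:ℝ)).norm_image_sub_le_of_norm_hasDerivWithin_le (C := 1) hℓd
    (fun r hr => (hℓspeed r hr).le) hs ht

/-- Solutions of the wave equation vanishing at `x = 0` have both Riemann invariants given by a
single continuous profile. -/
theorem exists_riemann_invariant {L : ℝ}
    (hlip : ∀ {s t : ℝ}, 0 ≤ s → 0 ≤ t → |ℓ t - ℓ s| ≤ |t - s|)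
    (hℓpos : ∀ t ∈ Ici (0:ℝ), 0 < ℓ t) (hL : ℓ 0 = L)
    {u : ℝ → ℝ → ℝ} {U : Set (ℝ × ℝ)} (hU : IsOpen U)
    (hUK : {p : ℝ × ℝ | 0 ≤ p.2 ∧ p.1 ∈ Icc 0 (ℓ p.2)} ⊆ U)
    (hu : ContDiffOn ℝ 2 (fun p : ℝ × ℝ => u p.1 p.2) U)
    (hwave : ∀ x t : ℝ, 0 ≤ t → x ∈ Icc 0 (ℓ t) →
      deriv (deriv (u x)) t = deriv (deriv (fun y => u y t)) x)
    (hbc0 : ∀ t : ℝ, 0 ≤ t → u 0 t = 0) :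
    ∃ h : ℝ → ℝ, ContinuousOn h (Ici (-L)) ∧ ∀ x t : ℝ, 0 ≤ t → x ∈ Icc 0 (ℓ t) →
      deriv (u x) t + deriv (fun y => u y t) x = h (t + x) ∧
      deriv (u x) t - deriv (fun y => u y t) x = -h (t - x) := by
  set f : ℝ × ℝ → ℝ := fun p => u p.1 p.2
  have hK : ∀ {x t : ℝ}, 0 ≤ t → 0 ≤ x → x ≤ ℓ t → (x, t) ∈ U :=
    fun ht hx hxl => hUK ⟨ht, hx, hxl⟩
  have hut : ∀ {x t : ℝ}, (x, t) ∈ U → HasDerivAt (u x) (fderiv ℝ f (x, t) (0, 1)) t :=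
    fun {x t} hz => hu.hasDerivAt_comp_curve hU (hasDerivAt_prodMk_right x t) hz
  have hux : ∀ {x t : ℝ}, (x, t) ∈ U →
      HasDerivAt (fun y => u y t) (fderiv ℝ f (x, t) (1, 0)) x :=
    fun {x t} hz => hu.hasDerivAt_comp_curve hU (c := fun y => (y, t))
      (hasDerivAt_prodMk_left x t) hz
  have e1 : ((1, 1) : ℝ × ℝ) = (0, 1) + (1, 0) := by simp
  have e2 : ((-1, 1) : ℝ × ℝ) = (0, 1) - (1, 0) := by simp
  have hchar : ∀ {x t : ℝ}, 0 ≤ t → 0 ≤ x → x ≤ ℓ t →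
      fderiv ℝ (fderiv ℝ f) (x, t) (-1, 1) (1, 1) = 0 ∧
      fderiv ℝ (fderiv ℝ f) (x, t) (1, 1) (-1, 1) = 0 := fun ht hx hxl =>
    hu.fderiv_fderiv_characteristic hU (hK ht hx hxl) (hwave _ _ ht ⟨hx, hxl⟩)
  have hbase : ∀ {s : ℝ}, -L ≤ s → max (-s) 0 ≤ ℓ (max s 0) := by
    intro s hs
    rcases le_total 0 s with h0 | h0
    · rw [max_eq_right (by linarith), max_eq_left h0]
      exact (hℓpos s h0).le
    · rw [max_eq_left (by linarith), max_eq_right h0, hL]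
      linarith
  have hbdry : ∀ {t : ℝ}, 0 ≤ t → fderiv ℝ f (0, t) (0, 1) = 0 := by
    intro t ht
    have h1 := (hut (hK ht le_rfl (hℓpos t ht).le)).hasDerivWithinAt (s := Ici 0)
    have h2 : HasDerivWithinAt (u 0) 0 (Ici 0) t :=
      (hasDerivWithinAt_const t (Ici 0) (0:ℝ)).congr (fun s hs => hbc0 s hs) (hbc0 t ht)
    exact (uniqueDiffOn_Ici (0:ℝ) t ht).eq_deriv _ h1 h2
  refine ⟨fun s => -fderiv ℝ f (max (-s) 0, max s 0) (-1, 1), ?_, ?_⟩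
  · have hcont : ContinuousOn (fderiv ℝ f) U := hu.continuousOn_fderiv_of_isOpen hU (by norm_num)
    have hcurve : Continuous fun s : ℝ => (max (-s) 0, max s 0) := by fun_prop
    exact ((hcont.comp hcurve.continuousOn fun s hs =>
      hK (le_max_right _ _) (le_max_right _ _) (hbase hs)).clm_apply continuousOn_const).neg
  · rintro x t ht ⟨hx, hxl⟩
    rw [(hut (hK ht hx hxl)).deriv, (hux (hK ht hx hxl)).deriv, ← map_add, ← map_sub, ← e1, ← e2]
    constructor
    · have hseg : ∀ s ∈ Icc 0 x, 0 ≤ t + s ∧ 0 ≤ x - s ∧ x - s ≤ ℓ (t + s) := by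
        rintro s ⟨hs0, hsx⟩
        have := neg_le_of_abs_le (hlip ht (add_nonneg ht hs0))
        rw [add_sub_cancel_left, abs_of_nonneg hs0] at this
        refine ⟨by linarith, by linarith, by linarith⟩
      have hpt : ∀ s : ℝ, (x, t) + s • ((-1, 1) : ℝ × ℝ) = (x - s, t + s) := fun s => by
        ext <;> simp [sub_eq_add_neg]
      have htr := hu.fderiv_apply_eq_of_segment hU (z := (x, t)) (v := (-1, 1)) (w := (1, 1)) hx
        (fun s hs => by
          rw [hpt]; obtain ⟨a, b, c⟩ := hseg s hs; exact hK a b c)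
        (fun s hs => by
          rw [hpt]; obtain ⟨a, b, c⟩ := hseg s hs; exact (hchar a b c).1)
      rw [hpt, sub_self] at htr
      have htx : 0 ≤ t + x := add_nonneg ht hx
      beta_reduce
      rw [← htr, max_eq_right (by linarith : -(t + x) ≤ 0), max_eq_left htx, e1, e2, map_add, map_sub,
        hbdry htx]
      ring
    · have hmin : 0 ≤ min x t := le_min hx ht
      have hx' : max (x - t) 0 + min x t = x := by
        rcases le_total x t with h | h <;> simp [h]
      have ht' : max (t - x) 0 + min x t = t := by
        rcases le_total x t with h | h <;> simp [h]
      have hseg : ∀ s ∈ Icc 0 (min x t), 0 ≤ max (t - x) 0 + s ∧ 0 ≤ max (x - t) 0 + s ∧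
          max (x - t) 0 + s ≤ ℓ (max (t - x) 0 + s) := by
        rintro s ⟨hs0, hsx⟩
        have h1 : 0 ≤ max (t - x) 0 + s := add_nonneg (le_max_right _ _) hs0
        have h2 : 0 ≤ max (x - t) 0 + s := add_nonneg (le_max_right _ _) hs0
        have h3 := le_of_abs_le (hlip h1 ht)
        rw [abs_of_nonneg (by linarith)] at h3
        exact ⟨h1, h2, by linarith⟩
      have hpt : ∀ s : ℝ, (max (x - t) 0, max (t - x) 0) + s • ((1, 1) : ℝ × ℝ) =
          (max (x - t) 0 + s, max (t - x) 0 + s) := fun s => by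
        ext <;> simp
      have htr := hu.fderiv_apply_eq_of_segment hU (z := (max (x - t) 0, max (t - x) 0))
        (v := (1, 1)) (w := (-1, 1)) hmin
        (fun s hs => by
          rw [hpt]; obtain ⟨a, b, c⟩ := hseg s hs; exact hK a b c)
        (fun s hs => by
          rw [hpt]; obtain ⟨a, b, c⟩ := hseg s hs; exact (hchar a b c).2)
      rw [hpt, hx', ht'] at htr
      rw [htr, neg_neg, neg_sub]

/-- An integral between the moving endpoints `t ± ℓ t` is conserved when the endpoint fluxes
balance. -/
theorem integral_moving_endpoints_eq {L : ℝ} {K : ℝ → ℝ} (hK : ContinuousOn K (Ici (-L)))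
    (hℓd : ∀ t ∈ Ici (0:ℝ), HasDerivWithinAt ℓ (ℓ' t) (Ici 0) t)
    (hlow : ∀ t, 0 ≤ t → -L ≤ t - ℓ t) (hhigh : ∀ t, 0 ≤ t → -L ≤ t + ℓ t)
    (hflux : ∀ t, 0 < t → K (t + ℓ t) * (1 + ℓ' t) = K (t - ℓ t) * (1 - ℓ' t))
    {t₀ t : ℝ} (ht₀ : 0 ≤ t₀) (htt : t₀ < t) :
    ∫ s in (t₀ - ℓ t₀)..(t₀ + ℓ t₀), K s = ∫ s in (t - ℓ t)..(t + ℓ t), K s := by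
  set J : ℝ → ℝ := fun s => K (max s (-L)) with hJ
  have hJc : Continuous J :=
    hK.comp_continuous (by fun_prop) fun s => mem_Ici.2 (le_max_right _ _)
  have hJK : ∀ s, -L ≤ s → J s = K s := fun s hs => by simp [hJ, max_eq_left hs]
  set G : ℝ → ℝ := fun s => ∫ r in (0:ℝ)..s, J r with hG
  have hGd : ∀ s, HasDerivAt G (J s) s := fun s =>
    intervalIntegral.integral_hasDerivAt_right (hJc.intervalIntegrable _ _)
      (hJc.stronglyMeasurableAtFilter _ _) hJc.continuousAt
  have hint : ∀ r, 0 ≤ r →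
      ∫ s in (r - ℓ r)..(r + ℓ r), K s = G (r + ℓ r) - G (r - ℓ r) := by
    intro r hr
    rw [hG, intervalIntegral.integral_interval_sub_left (hJc.intervalIntegrable _ _)
      (hJc.intervalIntegrable _ _)]
    refine intervalIntegral.integral_congr fun s hs => (hJK s ?_).symm
    exact (le_min (hlow r hr) (hhigh r hr)).trans hs.1
  have hcont : ContinuousOn (fun r => G (r + ℓ r) - G (r - ℓ r)) (Icc t₀ t) := by
    have hGc : Continuous G := continuous_iff_continuousAt.2 fun s => (hGd s).continuousAt
    have hℓc : ContinuousOn ℓ (Icc t₀ t) := fun r hr =>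
      (hℓd r (ht₀.trans hr.1)).continuousWithinAt.mono fun s hs => ht₀.trans hs.1
    exact (hGc.comp_continuousOn (continuousOn_id.add hℓc)).sub
      (hGc.comp_continuousOn (continuousOn_id.sub hℓc))
  have hder : ∀ r ∈ Ioo t₀ t, HasDerivAt (fun r => G (r + ℓ r) - G (r - ℓ r)) 0 r := by
    intro r hr
    have hr0 : 0 < r := ht₀.trans_lt hr.1
    have hl : HasDerivAt ℓ (ℓ' r) r := (hℓd r hr0.le).hasDerivAt (Ici_mem_nhds hr0)
    refine (((hGd (r + ℓ r)).comp r ((hasDerivAt_id r).add hl)).sub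
      ((hGd (r - ℓ r)).comp r ((hasDerivAt_id r).sub hl))).congr_deriv ?_
    rw [hJK _ (hlow r hr0.le), hJK _ (hhigh r hr0.le), hflux r hr0, sub_self]
  obtain ⟨c, hc, hslope⟩ := exists_hasDerivAt_eq_slope _ (fun _ => 0) htt hcont hder
  rw [hint _ ht₀, hint _ (ht₀.trans htt.le)]
  rw [eq_comm, div_eq_zero_iff] at hslope
  rcases hslope with h | h <;> linarith

end MovingBoundary

theorem integral_add_sq_comp_add_sub {h : ℝ → ℝ} {t a : ℝ} (ha : 0 ≤ a)
    (hc : ContinuousOn h (Icc (t - a) (t + a))) :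
    ∫ x in (0:ℝ)..a, (h (t + x) ^ 2 + h (t - x) ^ 2) = ∫ s in (t - a)..(t + a), h s ^ 2 := by
  have hplus : ContinuousOn (fun x => h (t + x) ^ 2) (Icc 0 a) :=
    (hc.comp (f := fun x => t + x) (by fun_prop) fun x hx =>
      ⟨by linarith [hx.1], by linarith [hx.2]⟩).pow 2
  have hminus : ContinuousOn (fun x => h (t - x) ^ 2) (Icc 0 a) :=
    (hc.comp (f := fun x => t - x) (by fun_prop) fun x hx =>
      ⟨by linarith [hx.2], by linarith [hx.1]⟩).pow 2
  rw [intervalIntegral.integral_add (hplus.intervalIntegrable_of_Icc ha)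
    (hminus.intervalIntegrable_of_Icc ha),
    intervalIntegral.integral_comp_add_left (fun s => h s ^ 2),
    intervalIntegral.integral_comp_sub_left (fun s => h s ^ 2), add_zero, sub_zero, add_comm]
  exact intervalIntegral.integral_add_adjacent_intervals
    (((hc.mono (Icc_subset_Icc le_rfl (by linarith))).pow 2).intervalIntegrable_of_Icc
      (by linarith))
    (((hc.mono (Icc_subset_Icc (by linarith) le_rfl)).pow 2).intervalIntegrable_of_Icc
      (by linarith))

/-- The symmetric minimum and maximum of a positive continuous function over `[t - a, t + a]`
are positive bounds for it. -/
theorem sInf_sSup_symmetric_bounds {g : ℝ → ℝ} {t a : ℝ} (ha : 0 ≤ a)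
    (hc : ContinuousOn g (Icc (t - a) (t + a))) (hpos : ∀ s ∈ Icc (t - a) (t + a), 0 < g s) :
    0 < sInf ((fun x => min (g (t - x)) (g (t + x))) '' Icc 0 a) ∧
    ∀ s ∈ Icc (t - a) (t + a),
      sInf ((fun x => min (g (t - x)) (g (t + x))) '' Icc 0 a) ≤ g s ∧
      g s ≤ sSup ((fun x => max (g (t - x)) (g (t + x))) '' Icc 0 a) := by
  have hmplus : MapsTo (fun x => t + x) (Icc 0 a) (Icc (t - a) (t + a)) := fun x hx =>
    ⟨by linarith [hx.1], by linarith [hx.2]⟩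
  have hmminus : MapsTo (fun x => t - x) (Icc 0 a) (Icc (t - a) (t + a)) := fun x hx =>
    ⟨by linarith [hx.2], by linarith [hx.1]⟩
  have hplus : ContinuousOn (fun x => g (t + x)) (Icc 0 a) := hc.comp (by fun_prop) hmplus
  have hminus : ContinuousOn (fun x => g (t - x)) (Icc 0 a) := hc.comp (by fun_prop) hmminus
  have hcmin := isCompact_Icc.image_of_continuousOn (hminus.inf hplus)
  have hcmax := isCompact_Icc.image_of_continuousOn (hminus.sup hplus)
  constructor
  · obtain ⟨x, hx, hxe⟩ := hcmin.sInf_mem ((nonempty_Icc.2 ha).image _)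
    exact (lt_min (hpos _ (hmminus hx)) (hpos _ (hmplus hx))).trans_eq hxe
  · intro s hs
    have hx : |s - t| ∈ Icc 0 a :=
      ⟨abs_nonneg _, abs_le.2 ⟨by linarith [hs.1], by linarith [hs.2]⟩⟩
    have hi := csInf_le hcmin.bddBelow (mem_image_of_mem _ hx)
    have hsup := le_csSup hcmax.bddAbove (mem_image_of_mem _ hx)
    rcases le_total t s with h | h
    · have e : t + |s - t| = s := by rw [abs_of_nonneg (by linarith)]; ring
      exact ⟨hi.trans ((min_le_right _ _).trans_eq (congrArg g e)),
        ((congrArg g e.symm).trans_le (le_max_right _ _)).trans hsup⟩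
    · have e : t - |s - t| = s := by rw [abs_of_nonpos (by linarith)]; ring
      exact ⟨hi.trans ((min_le_left _ _).trans_eq (congrArg g e)),
        ((congrArg g e.symm).trans_le (le_max_left _ _)).trans hsup⟩

/-- Comparison of `∫ h²` with the weighted integral `∫ h² e^{cφ} / φ'`. -/
theorem weighted_integral_sq_bounds {h φ φ' : ℝ → ℝ} {a b c m M : ℝ} (hab : a ≤ b) (hc : 0 ≤ c)
    (hh : ContinuousOn h (Icc a b)) (hφ : ContinuousOn φ (Icc a b))
    (hφ' : ContinuousOn φ' (Icc a b)) (hmono : MonotoneOn φ (Icc a b)) (hm : 0 < m)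
    (hmM : ∀ s ∈ Icc a b, m ≤ φ' s ∧ φ' s ≤ M) :
    Real.exp (c * φ a) / M * (∫ s in a..b, h s ^ 2) ≤
        ∫ s in a..b, h s ^ 2 / φ' s * Real.exp (c * φ s) ∧
      ∫ s in a..b, h s ^ 2 / φ' s * Real.exp (c * φ s) ≤
        Real.exp (c * φ b) / m * ∫ s in a..b, h s ^ 2 := by
  have hK : ContinuousOn (fun s => h s ^ 2 / φ' s * Real.exp (c * φ s)) (Icc a b) :=
    ((hh.pow 2).div hφ' fun s hs => (hm.trans_le (hmM s hs).1).ne').mul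
      (continuousOn_const.mul hφ).rexp
  have hi := hK.intervalIntegrable_of_Icc (μ := MeasureTheory.volume) hab
  have hconst : ∀ C : ℝ, IntervalIntegrable (fun s => C * h s ^ 2) MeasureTheory.volume a b :=
    fun C => (continuousOn_const.mul (hh.pow 2)).intervalIntegrable_of_Icc hab
  rw [← intervalIntegral.integral_const_mul, ← intervalIntegral.integral_const_mul]
  constructor
  · refine intervalIntegral.integral_mono_on hab (hconst _) hi fun s hs => ?_
    have h1 : φ a ≤ φ s := hmono (left_mem_Icc.2 hab) hs hs.1
    have h2 : 0 < φ' s := hm.trans_le (hmM s hs).1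
    calc Real.exp (c * φ a) / M * h s ^ 2 ≤ Real.exp (c * φ s) / φ' s * h s ^ 2 := by
          gcongr
          exact (hmM s hs).2
      _ = _ := by ring
  · refine intervalIntegral.integral_mono_on hab hi (hconst _) fun s hs => ?_
    have h1 : φ s ≤ φ b := hmono hs (right_mem_Icc.2 hab) hs.2
    calc h s ^ 2 / φ' s * Real.exp (c * φ s) = Real.exp (c * φ s) / φ' s * h s ^ 2 := by ring
      _ ≤ Real.exp (c * φ b) / m * h s ^ 2 := by
          gcongr
          exact (hmM s hs).1

theorem one_lt_abs_damping_ratio {η : ℝ} (hη0 : 0 < η) (hη1 : η ≠ 1) :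
    1 < |(1 + η) / (1 - η)| := by
  rw [abs_div, one_lt_div (abs_pos.2 (sub_ne_zero.2 hη1.symm)),
    abs_of_pos (by linarith : 0 < 1 + η)]
  exact abs_lt.2 ⟨by linarith, by linarith⟩

/-- Balance of the weighted fluxes at the two endpoints of a characteristic reflected at the
damped boundary. Here `a, b` are the profile values, `A, B` the derivatives of `φ`, and `p, q` the
values of `φ`, before and after reflection; `v` is the boundary speed. -/
theorem damped_reflection_flux_balance {η a b A B p q v : ℝ} (hη0 : 0 < η) (hη1 : η ≠ 1)
    (hA : 0 < A) (hB : 0 < B)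
    (hrefl : (1 + η) * (1 + v) * b = -((1 - η) * (1 - v) * a))
    (hAB : B * (1 + v) = A * (1 - v)) (hpq : q - p = 2) :
    b ^ 2 / B * Real.exp (Real.log |(1 + η) / (1 - η)| * q) * (1 + v) =
      a ^ 2 / A * Real.exp (Real.log |(1 + η) / (1 - η)| * p) * (1 - v) := by
  set γ := (1 + η) / (1 - η) with hγ
  have hη : 1 - η ≠ 0 := sub_ne_zero.2 hη1.symm
  have hγ0 : 0 < |γ| := zero_lt_one.trans (one_lt_abs_damping_ratio hη0 hη1)
  have hexp : Real.exp (Real.log |γ| * q) = γ ^ 2 * Real.exp (Real.log |γ| * p) := by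
    have : Real.log |γ| * q = Real.log |γ| + Real.log |γ| + Real.log |γ| * p := by
      rw [show q = p + 2 by linarith]; ring
    rw [this, Real.exp_add, Real.exp_add, Real.exp_log hγ0, ← sq, sq_abs]
  have hrefl' : γ * ((1 + v) * b) = -((1 - v) * a) := by
    rw [hγ]; field_simp; linarith
  rw [hexp]
  have hAe : (1 - v) = B * (1 + v) / A := by rw [hAB]; field_simp
  rw [hAe] at hrefl' ⊢
  by_cases hv : 1 + v = 0
  · simp [hv]
  have hγb : γ * b * A = -(B * a) := by
    field_simp at hrefl'
    linarith
  have : γ ^ 2 * b ^ 2 * A ^ 2 = B ^ 2 * a ^ 2 := by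
    linear_combination (γ * b * A - B * a) * hγb
  field_simp
  linear_combination this

theorem damped_energy_two_sided_estimate
    (L : ℝ) (ℓ ℓ' : ℝ → ℝ)
    (hℓC1 : ContDiffOn ℝ 1 ℓ (Set.Ici 0))
    (hℓd : ∀ t ∈ Set.Ici (0:ℝ), HasDerivWithinAt ℓ (ℓ' t) (Set.Ici 0) t)
    (hℓpos : ∀ t ∈ Set.Ici (0:ℝ), 0 < ℓ t)
    (hℓspeed : ∀ t ∈ Set.Ici (0:ℝ), |ℓ' t| < 1)
    (hL : ℓ 0 = L)
    (u : ℝ → ℝ → ℝ) (U : Set (ℝ × ℝ)) (hUopen : IsOpen U)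
    (hUK : {p : ℝ × ℝ | 0 ≤ p.2 ∧ p.1 ∈ Set.Icc 0 (ℓ p.2)} ⊆ U)
    (huC2 : ContDiffOn ℝ 2 (fun p : ℝ × ℝ => u p.1 p.2) U)
    (hwave : ∀ x t : ℝ, 0 ≤ t → x ∈ Set.Icc 0 (ℓ t) →
      deriv (deriv (u x)) t = deriv (deriv (fun y => u y t)) x)
    (hbc0 : ∀ t : ℝ, 0 ≤ t → u 0 t = 0)
    (η : ℝ) (hη0 : 0 < η) (hη1 : η ≠ 1)
    (hbcℓ : ∀ t : ℝ, 0 < t →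
      (1 + η * ℓ' t) * deriv (fun y => u y t) (ℓ t)
        + (η + ℓ' t) * deriv (u (ℓ t)) t = 0)
    (φ φ' : ℝ → ℝ)
    (hφC1 : ContDiffOn ℝ 1 φ (Set.Ici (-L)))
    (hφd : ∀ s ∈ Set.Ici (-L), HasDerivWithinAt φ (φ' s) (Set.Ici (-L)) s)
    (hφpos : ∀ s ∈ Set.Ici (-L), 0 < φ' s)
    (hMoore : ∀ t ∈ Set.Ici (0:ℝ), φ (t + ℓ t) - φ (t - ℓ t) = 2)
    (E : ℝ → ℝ)
    (hE : ∀ t : ℝ, E t = (1/2) * ∫ x in (0:ℝ)..(ℓ t),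
      ((deriv (u x) t)^2 + (deriv (fun y => u y t) x)^2))
    (m M : ℝ → ℝ)
    (hm : ∀ t : ℝ, m t = sInf ((fun x => min (φ' (t - x)) (φ' (t + x))) '' Set.Icc 0 (ℓ t)))
    (hM : ∀ t : ℝ, M t = sSup ((fun x => max (φ' (t - x)) (φ' (t + x))) '' Set.Icc 0 (ℓ t)))
    (γ : ℝ) (hγ : γ = (1 + η) / (1 - η))
    : ∀ t₀ t : ℝ, 0 ≤ t₀ → t₀ < t →
      Real.exp (Real.log |γ| * φ (t₀ - ℓ t₀)) / M t₀ * m t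
          * Real.exp (-(Real.log |γ|) * φ (t + ℓ t)) * E t₀ ≤ E t ∧
      E t ≤ Real.exp (Real.log |γ| * φ (t₀ + ℓ t₀)) / m t₀ * M t
          * Real.exp (-(Real.log |γ|) * φ (t - ℓ t)) * E t₀ := by
  subst hγ
  have hlip : ∀ {s t : ℝ}, 0 ≤ s → 0 ≤ t → |ℓ t - ℓ s| ≤ |t - s| := fun hs ht =>
    abs_sub_le_of_abs_hasDerivWithinAt_lt_one hℓd hℓspeed hs ht
  have hlow : ∀ t, 0 ≤ t → -L ≤ t - ℓ t := fun t ht => by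
    have := le_of_abs_le (hlip le_rfl ht)
    rw [sub_zero, abs_of_nonneg ht] at this
    linarith
  have hhigh : ∀ t, 0 ≤ t → -L ≤ t + ℓ t := fun t ht => by
    linarith [hlow t ht, hℓpos t ht]
  have hφ'c : ContinuousOn φ' (Set.Ici (-L)) :=
    (hφC1.continuousOn_derivWithin (uniqueDiffOn_Ici _) le_rfl).congr fun s hs =>
      ((hφd s hs).derivWithin (uniqueDiffOn_Ici _ s hs)).symm
  have hφc : ContinuousOn φ (Set.Ici (-L)) := hφC1.continuousOn
  have hφmono : MonotoneOn φ (Set.Ici (-L)) :=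
    monotoneOn_of_hasDerivWithinAt_nonneg (convex_Ici _) hφc
      (fun s hs => (hφd s (interior_subset hs)).mono interior_subset)
      fun s hs => (hφpos s (interior_subset hs)).le
  obtain ⟨h, hhc, hh⟩ :=
    exists_riemann_invariant hlip hℓpos hL hUopen hUK huC2 hwave hbc0
  have hsub : ∀ t, 0 ≤ t → Set.Icc (t - ℓ t) (t + ℓ t) ⊆ Set.Ici (-L) := fun t ht s hs =>
    (hlow t ht).trans hs.1
  have hEh : ∀ t, 0 ≤ t → E t = 1 / 4 * ∫ s in (t - ℓ t)..(t + ℓ t), h s ^ 2 := by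
    intro t ht
    have hl := (hℓpos t ht).le
    rw [hE, ← integral_add_sq_comp_add_sub hl (hhc.mono (hsub t ht)),
      show (1 / 4 : ℝ) = 1 / 2 * (1 / 2) by norm_num, mul_assoc,
      ← intervalIntegral.integral_const_mul (1 / 2 : ℝ) fun x => h (t + x) ^ 2 + h (t - x) ^ 2]
    congr 1
    refine intervalIntegral.integral_congr fun x hx => ?_
    rw [Set.uIcc_of_le hl] at hx
    obtain ⟨h1, h2⟩ := hh x t ht hx
    have h3 : h (t - x) = -(deriv (u x) t - deriv (fun y => u y t) x) := by rw [h2, neg_neg]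
    simp only [← h1, h3]
    ring
  have hMoore' : ∀ t, 0 ≤ t → φ' (t + ℓ t) * (1 + ℓ' t) = φ' (t - ℓ t) * (1 - ℓ' t) := by
    intro t ht
    have hp := (hφd _ (hhigh t ht)).comp t ((hasDerivWithinAt_id t _).add (hℓd t ht))
      (fun s hs => hhigh s hs)
    have hq := (hφd _ (hlow t ht)).comp t ((hasDerivWithinAt_id t _).sub (hℓd t ht))
      (fun s hs => hlow s hs)
    have h0 : HasDerivWithinAt (fun s => φ (s + ℓ s) - φ (s - ℓ s)) 0 (Set.Ici 0) t :=
      (hasDerivWithinAt_const t (Set.Ici 0) (2:ℝ)).congr hMoore (hMoore t ht)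
    exact sub_eq_zero.1 ((uniqueDiffOn_Ici (0:ℝ) t ht).eq_deriv _ (hp.sub hq) h0)
  set c := Real.log |(1 + η) / (1 - η)|
  have hc0 : 0 ≤ c := (Real.log_pos (one_lt_abs_damping_ratio hη0 hη1)).le
  have hflux : ∀ t, 0 < t →
      (h (t + ℓ t) ^ 2 / φ' (t + ℓ t) * Real.exp (c * φ (t + ℓ t))) * (1 + ℓ' t) =
      (h (t - ℓ t) ^ 2 / φ' (t - ℓ t) * Real.exp (c * φ (t - ℓ t))) * (1 - ℓ' t) := by
    intro t ht
    refine damped_reflection_flux_balance hη0 hη1 (hφpos _ (hlow t ht.le))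
      (hφpos _ (hhigh t ht.le)) ?_ (hMoore' t ht.le) (hMoore t ht.le)
    obtain ⟨h1, h2⟩ := hh (ℓ t) t ht.le ⟨(hℓpos t ht.le).le, le_rfl⟩
    linear_combination 2 * hbcℓ t ht - (1 + η) * (1 + ℓ' t) * h1 + (1 - η) * (1 - ℓ' t) * h2
  have hKc : ContinuousOn (fun s => h s ^ 2 / φ' s * Real.exp (c * φ s)) (Set.Ici (-L)) :=
    ((hhc.pow 2).div hφ'c fun s hs => (hφpos s hs).ne').mul (continuousOn_const.mul hφc).rexp
  have hmM : ∀ t, 0 ≤ t → 0 < m t ∧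
      ∀ s ∈ Set.Icc (t - ℓ t) (t + ℓ t), m t ≤ φ' s ∧ φ' s ≤ M t := by
    intro t ht
    rw [hm, hM]
    exact sInf_sSup_symmetric_bounds (hℓpos t ht).le (hφ'c.mono (hsub t ht))
      fun s hs => hφpos s (hsub t ht hs)
  have hM0 : ∀ t, 0 ≤ t → 0 < M t := fun t ht => by
    obtain ⟨h1, h2⟩ := hmM t ht
    have hl := hℓpos t ht
    obtain ⟨h3, h4⟩ := h2 t ⟨by linarith, by linarith⟩
    linarith
  have hbounds := fun t (ht : 0 ≤ t) =>
    weighted_integral_sq_bounds (a := t - ℓ t) (b := t + ℓ t) (by linarith [hℓpos t ht]) hc0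
      (hhc.mono (hsub t ht)) (hφc.mono (hsub t ht)) (hφ'c.mono (hsub t ht))
      (hφmono.mono (hsub t ht)) (hmM t ht).1 (hmM t ht).2
  intro t₀ t ht₀ htt
  have ht : 0 ≤ t := ht₀.trans htt.le
  have hcons := integral_moving_endpoints_eq hKc hℓd hlow hhigh hflux ht₀ htt
  obtain ⟨hl₀, hu₀⟩ := hbounds t₀ ht₀
  obtain ⟨hl, hu⟩ := hbounds t ht
  rw [hcons] at hl₀ hu₀
  rw [hEh t ht, hEh t₀ ht₀]
  set I₀ := ∫ s in (t₀ - ℓ t₀)..(t₀ + ℓ t₀), h s ^ 2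
  set I := ∫ s in (t - ℓ t)..(t + ℓ t), h s ^ 2
  have hmt := (hmM t ht).1
  have hMt := hM0 t ht
  constructor
  · have key := mul_le_mul_of_nonneg_left (hl₀.trans hu)
      (mul_pos hmt (Real.exp_pos (-c * φ (t + ℓ t)))).le
    have e : m t * Real.exp (-c * φ (t + ℓ t)) * (Real.exp (c * φ (t + ℓ t)) / m t * I) = I := by
      rw [neg_mul, Real.exp_neg]
      field_simp
    rw [e] at key
    linarith
  · have key := mul_le_mul_of_nonneg_left (hl.trans hu₀)
      (mul_pos hMt (Real.exp_pos (-c * φ (t - ℓ t)))).le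
    have e : M t * Real.exp (-c * φ (t - ℓ t)) * (Real.exp (c * φ (t - ℓ t)) / M t * I) = I := by
      rw [neg_mul, Real.exp_neg]
      field_simp
    rw [e] at key
    linarith
end
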